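/- Sure success of the interval MK test (part a): Let f : ℝⁿ → ℝⁿ be twice continuously differentiable, α a zero of f, and B a box of width w > 0 containing α. Let λ ≥ w, let Δ be the closed Euclidean ball of radius 2√n·λ centered at α, and assume J(x) is invertible for all x ∈ Δ and 27·n·λ·sup{ ‖ |J(x)⁻¹| · K(Δ) ‖ : x ∈ Δ } ≤ 1 (|J(x)⁻¹| is the entrywise absolute value). Let m ∈ B and g := J(m)⁻¹·f. For each i ∈ {1,…,n}, each sign s ∈ {+,−}, and each j ≠ i, let I_{ij}^s be a nonempty compact interval with {∂g_i/∂x_j(x) : x ∈ (2B)_i^s} ⊆ I_{ij}^s and w(I_{ij}^s) ≤ 1/(32n). Let c_i^s denote the center of the face (2B)_i^s. Then for every i: every element of the interval g_i(c_i^+) + Σ_{j≠i} I_{ij}^+·[−w, w] is ≥ w/8 > 0, and every element of the interval g_i(c_i^-) + Σ_{j≠i} I_{ij}^-·[−w, w] is ≤ −w/8 < 0. -/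

import Mathlib

/-- The partial derivative `∂f_i/∂x_j` at `x`. -/
noncomputable def pd (n : ℕ) (f : (Fin n → ℝ) → (Fin n → ℝ)) (i j : Fin n)
    (x : Fin n → ℝ) : ℝ :=
  fderiv ℝ (fun y => f y i) x (Pi.single j 1)

/-- The Jacobian matrix of `f` at `x`. -/
noncomputable def Jmat (n : ℕ) (f : (Fin n → ℝ) → (Fin n → ℝ))
    (x : Fin n → ℝ) : Matrix (Fin n) (Fin n) ℝ :=
  fun i j => pd n f i j x

/-- The matrix `K(C)` with entries `K(C)_{ij} = Σ_k sup_{x∈C} |∂²f_i/(∂x_j∂x_k)(x)|`. -/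
noncomputable def Kmat (n : ℕ) (f : (Fin n → ℝ) → (Fin n → ℝ))
    (C : Set (Fin n → ℝ)) : Matrix (Fin n) (Fin n) ℝ :=
  fun i j => ∑ k, sSup ((fun x => |fderiv ℝ (pd n f i j) x (Pi.single k 1)|) '' C)

/-- The maximum-absolute-row-sum norm of a matrix. -/
noncomputable def rowSumNorm (n : ℕ) (A : Matrix (Fin n) (Fin n) ℝ) : ℝ :=
  ⨆ i, ∑ j, |A i j|

/-- The Euclidean distance on `Fin n → ℝ`. -/
noncomputable def eudist (n : ℕ) (x y : Fin n → ℝ) : ℝ :=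
  Real.sqrt (∑ i, (x i - y i) ^ 2)

/-- The box of width `w` centered at `c`. -/
def box (n : ℕ) (c : Fin n → ℝ) (w : ℝ) : Set (Fin n → ℝ) :=
  Set.Icc (fun i => c i - w / 2) (fun i => c i + w / 2)

/-- The `i`-th upper face of the box of width `w` centered at `c`. -/
def facePlus (n : ℕ) (c : Fin n → ℝ) (w : ℝ) (i : Fin n) : Set (Fin n → ℝ) :=
  {x ∈ box n c w | x i = c i + w / 2}

/-- The `i`-th lower face of the box of width `w` centered at `c`. -/
def faceMinus (n : ℕ) (c : Fin n → ℝ) (w : ℝ) (i : Fin n) : Set (Fin n → ℝ) :=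
  {x ∈ box n c w | x i = c i - w / 2}

/-- A linear functional on `Fin n → ℝ` is bounded by the sum of its values on the basis. -/
theorem norm_le_sum_abs_apply_single {n : ℕ} (L : (Fin n → ℝ) →L[ℝ] ℝ) :
    ‖L‖ ≤ ∑ k, |L (Pi.single k 1)| := by
  refine L.opNorm_le_bound (Finset.sum_nonneg fun _ _ => abs_nonneg _) fun v => ?_
  have hv : L v = ∑ k, v k * L (Pi.single k 1) := by
    conv_lhs => rw [pi_eq_sum_univ' v]
    simp only [map_sum, map_smul, smul_eq_mul]
  rw [hv, Finset.sum_mul, Real.norm_eq_abs]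
  refine (Finset.abs_sum_le_sum_abs _ _).trans (Finset.sum_le_sum fun k _ => ?_)
  rw [abs_mul, mul_comm]
  exact mul_le_mul_of_nonneg_left (norm_le_pi_norm v k) (abs_nonneg _)

theorem contDiff_pd {n : ℕ} {f : (Fin n → ℝ) → (Fin n → ℝ)} (hf : ContDiff ℝ 2 f)
    (i j : Fin n) : ContDiff ℝ 1 (pd n f i j) := by
  have h : ContDiff ℝ 2 fun y => f y i := contDiff_pi.1 hf i
  exact (h.fderiv_right (m := 1) (by norm_num)).clm_apply contDiff_const

theorem abs_pd_sub_le {n : ℕ} {f : (Fin n → ℝ) → (Fin n → ℝ)} (hf : ContDiff ℝ 2 f)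
    {C S : Set (Fin n → ℝ)} (hC : IsCompact C) (hS : Convex ℝ S) (hSC : S ⊆ C)
    (i j : Fin n) {x y : Fin n → ℝ} (hx : x ∈ S) (hy : y ∈ S) :
    |pd n f i j x - pd n f i j y| ≤ Kmat n f C i j * ‖x - y‖ := by
  have h1 := contDiff_pd hf i j
  refine hS.norm_image_sub_le_of_norm_fderiv_le (𝕜 := ℝ)
    (fun z _ => (h1.differentiable one_ne_zero) z) (fun z hz => ?_) hy hx
  refine (norm_le_sum_abs_apply_single _).trans (Finset.sum_le_sum fun k _ => ?_)
  refine le_csSup (hC.bddAbove_image ?_) ⟨z, hSC hz, rfl⟩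
  exact ((h1.continuous_fderiv one_ne_zero).clm_apply continuous_const).abs.continuousOn

theorem isCompact_eudist_le (n : ℕ) (α : Fin n → ℝ) (r : ℝ) :
    IsCompact {x | eudist n α x ≤ r} := by
  refine Metric.isCompact_of_isClosed_isBounded ?_ ?_
  · refine isClosed_le ?_ continuous_const
    unfold eudist
    fun_prop
  · refine (Metric.isBounded_closedBall (x := α) (r := max r 0)).subset fun x hx => ?_
    rw [Metric.mem_closedBall, dist_pi_le_iff (le_max_right _ _)]
    intro i
    refine le_trans ?_ (le_max_left r 0)
    refine le_trans ?_ (Set.mem_ofPred.1 hx)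
    rw [Real.dist_eq, abs_sub_comm]
    refine Real.abs_le_sqrt ?_
    exact Finset.single_le_sum (f := fun i => (α i - x i) ^ 2)
      (fun _ _ => sq_nonneg _) (Finset.mem_univ i)

theorem eudist_le_sqrt_mul {n : ℕ} {x y : Fin n → ℝ} {r : ℝ} (hr : 0 ≤ r)
    (h : ∀ i, |x i - y i| ≤ r) : eudist n x y ≤ Real.sqrt n * r := by
  refine Real.sqrt_le_iff.2 ⟨by positivity, ?_⟩
  rw [mul_pow, Real.sq_sqrt n.cast_nonneg]
  calc ∑ i, (x i - y i) ^ 2 ≤ ∑ _i : Fin n, r ^ 2 :=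
        Finset.sum_le_sum fun i _ => sq_le_sq' (abs_le.1 (h i)).1 (abs_le.1 (h i)).2
    _ = n * r ^ 2 := by simp

theorem mem_box_iff {n : ℕ} {c x : Fin n → ℝ} {w : ℝ} :
    x ∈ box n c w ↔ ∀ i, |x i - c i| ≤ w / 2 := by
  simp only [box, Set.mem_Icc, Pi.le_def, abs_le, ← forall_and]
  refine forall_congr' fun i => and_congr ?_ ?_ <;> constructor <;> intro h <;> linarith

theorem abs_sub_le_of_mem_box {n : ℕ} {c x y : Fin n → ℝ} {w : ℝ} (hx : x ∈ box n c (2 * w))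
    (hy : y ∈ box n c w) (i : Fin n) : |x i - y i| ≤ 3 / 2 * w := by
  have h1 := abs_le.1 (mem_box_iff.1 hx i)
  have h2 := abs_le.1 (mem_box_iff.1 hy i)
  exact abs_le.2 ⟨by linarith, by linarith⟩

theorem le_rowSumNorm (n : ℕ) (A : Matrix (Fin n) (Fin n) ℝ) (i : Fin n) :
    ∑ j, |A i j| ≤ rowSumNorm n A :=
  le_ciSup (f := fun i => ∑ j, |A i j|) (Set.finite_range _).bddAbove i

/-- Row sums of `|J(x)⁻¹| * K` are bounded by the supremum over a compact set. -/
theorem sum_le_sSup_rowSumNorm {n : ℕ} {f : (Fin n → ℝ) → (Fin n → ℝ)} (hf : ContDiff ℝ 2 f)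
    {C : Set (Fin n → ℝ)} (hC : IsCompact C) (hinv : ∀ x ∈ C, IsUnit (Jmat n f x))
    (K : Matrix (Fin n) (Fin n) ℝ) {x : Fin n → ℝ} (hx : x ∈ C) (i : Fin n) :
    ∑ j, |(((Jmat n f x)⁻¹.map fun a => |a|) * K) i j| ≤
      sSup ((fun x => rowSumNorm n (((Jmat n f x)⁻¹.map fun a => |a|) * K)) '' C) := by
  have hJ : Continuous (Jmat n f) :=
    continuous_pi fun i => continuous_pi fun j => (contDiff_pd hf i j).continuous
  have hJinv : ContinuousOn (fun x => (Jmat n f x)⁻¹) C := by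
    have hdet : ContinuousOn (fun x => Ring.inverse (Jmat n f x).det) C := by
      simp only [Ring.inverse_eq_inv']
      exact hJ.matrix_det.continuousOn.inv₀ fun y hy =>
        ((Matrix.isUnit_iff_isUnit_det _).1 (hinv y hy)).ne_zero
    exact hdet.smul hJ.matrix_adjugate.continuousOn
  have hrow : ∀ i, ContinuousOn
      (fun x => ∑ j, |(((Jmat n f x)⁻¹.map fun a => |a|) * K) i j|) C := by
    intro i
    simp only [Matrix.mul_apply, Matrix.map_apply]
    have hentry : ∀ k, ContinuousOn (fun x => (Jmat n f x)⁻¹ i k) C := fun k =>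
      continuousOn_pi.1 (continuousOn_pi.1 hJinv i) k
    exact continuousOn_finsetSum _ fun j _ =>
      (continuousOn_finsetSum _ fun k _ => (hentry k).abs.mul continuousOn_const).abs
  have hbdd : BddAbove
      ((fun x => rowSumNorm n (((Jmat n f x)⁻¹.map fun a => |a|) * K)) '' C) := by
    choose b hb using fun i => hC.bddAbove_image (hrow i)
    have : Nonempty (Fin n) := ⟨i⟩
    refine ⟨∑ i, |b i|, ?_⟩
    rintro _ ⟨y, hy, rfl⟩
    refine ciSup_le fun k => (hb k ⟨y, hy, rfl⟩).trans ((le_abs_self _).trans ?_)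
    exact Finset.single_le_sum (f := fun i => |b i|) (fun _ _ => abs_nonneg _)
      (Finset.mem_univ k)
  exact (le_rowSumNorm n _ i).trans (le_csSup hbdd ⟨x, hx, rfl⟩)

theorem pd_mulVec {n : ℕ} {f g : (Fin n → ℝ) → (Fin n → ℝ)} (hf : Differentiable ℝ f)
    {M : Matrix (Fin n) (Fin n) ℝ} (hg : ∀ x, g x = M.mulVec (f x)) (i j : Fin n)
    (x : Fin n → ℝ) : pd n g i j x = ∑ k, M i k * pd n f k j x := by
  have hd : ∀ k, DifferentiableAt ℝ (fun y => f y k) x := fun k => differentiableAt_pi.1 (hf x) k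
  have hgi : (fun y => g y i) = fun y => ∑ k, M i k * f y k := by
    ext y
    rw [hg y]
    rfl
  unfold pd
  rw [hgi, fderiv_fun_sum fun k _ => (hd k).const_mul _, sum_apply]
  refine Finset.sum_congr rfl fun k _ => ?_
  rw [fderiv_const_mul (hd k)]
  rfl

/-- Preconditioning with `J(m)⁻¹` makes the Jacobian close to the identity, row by row. -/
theorem sum_abs_pd_sub_one_le {n : ℕ} {f g : (Fin n → ℝ) → (Fin n → ℝ)} (hf : ContDiff ℝ 2 f)
    {C S : Set (Fin n → ℝ)} (hC : IsCompact C) (hS : Convex ℝ S) (hSC : S ⊆ C)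
    {x m : Fin n → ℝ} (hx : x ∈ S) (hm : m ∈ S) (hunit : IsUnit (Jmat n f m))
    (hg : ∀ x, g x = (Jmat n f m)⁻¹.mulVec (f x)) (i : Fin n) :
    ∑ j, |pd n g i j x - (1 : Matrix (Fin n) (Fin n) ℝ) i j| ≤
      (∑ j, |(((Jmat n f m)⁻¹.map fun a => |a|) * Kmat n f C) i j|) * ‖x - m‖ := by
  rw [Finset.sum_mul]
  refine Finset.sum_le_sum fun j _ => ?_
  have h1 : (1 : Matrix (Fin n) (Fin n) ℝ) i j =
      ∑ k, (Jmat n f m)⁻¹ i k * pd n f k j m := by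
    rw [← Matrix.nonsing_inv_mul _ ((Matrix.isUnit_iff_isUnit_det _).1 hunit), Matrix.mul_apply]
    rfl
  rw [h1, pd_mulVec (hf.differentiable two_ne_zero) hg, ← Finset.sum_sub_distrib]
  refine (Finset.abs_sum_le_sum_abs _ _).trans ?_
  refine le_trans ?_ (mul_le_mul_of_nonneg_right (le_abs_self _) (norm_nonneg _))
  rw [Matrix.mul_apply, Finset.sum_mul]
  refine Finset.sum_le_sum fun k _ => ?_
  rw [← mul_sub, abs_mul, Matrix.map_apply, mul_assoc]
  exact mul_le_mul_of_nonneg_left (abs_pd_sub_le hf hC hS hSC k j hx hm) (abs_nonneg _)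

/-- If the `i`-th row of the Jacobian is close to that of the identity, then `g · i` is close to
the `i`-th coordinate up to a constant. -/
theorem abs_sub_sub_sub_le {n : ℕ} {g : (Fin n → ℝ) → (Fin n → ℝ)} (hg : Differentiable ℝ g)
    {S : Set (Fin n → ℝ)} (hS : Convex ℝ S) {i : Fin n} {ε : ℝ}
    (h : ∀ x ∈ S, ∑ j, |pd n g i j x - (1 : Matrix (Fin n) (Fin n) ℝ) i j| ≤ ε)
    {x y : Fin n → ℝ} (hx : x ∈ S) (hy : y ∈ S) :
    |(g x i - x i) - (g y i - y i)| ≤ ε * ‖x - y‖ := by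
  have hd : ∀ z, DifferentiableAt ℝ (fun y => g y i) z := fun z => differentiableAt_pi.1 (hg z) i
  have hp : ∀ z : Fin n → ℝ, DifferentiableAt ℝ (fun y : Fin n → ℝ => y i) z :=
    fun z => differentiableAt_apply i z
  refine hS.norm_image_sub_le_of_norm_fderiv_le (𝕜 := ℝ) (f := fun y => g y i - y i)
    (fun z _ => (hd z).sub (hp z)) (fun z hz => ?_) hy hx
  refine (norm_le_sum_abs_apply_single _).trans (le_trans (le_of_eq ?_) (h z hz))
  refine Finset.sum_congr rfl fun j _ => ?_
  have hi : fderiv ℝ (fun y : Fin n → ℝ => y i) z = ContinuousLinearMap.proj i :=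
    (ContinuousLinearMap.proj (R := ℝ) (φ := fun _ : Fin n => ℝ) i).fderiv
  rw [fderiv_fun_sub (hd z) (hp z), hi, sub_apply, ContinuousLinearMap.proj_apply,
    Pi.single_apply, Matrix.one_apply]
  rfl

/-- A weighted sum over enclosing intervals is small if the enclosed row is close to the identity
row and the intervals are narrow. -/
theorem abs_sum_erase_mul_le {n : ℕ} (i : Fin n) {p a b t s : Fin n → ℝ} {ε δ w : ℝ} (hw : 0 ≤ w)
    (hδ : 0 ≤ δ)
    (hp : ∑ j, |p j - (1 : Matrix (Fin n) (Fin n) ℝ) i j| ≤ ε)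
    (hpI : ∀ j, j ≠ i → p j ∈ Set.Icc (a j) (b j))
    (hab : ∀ j, j ≠ i → b j - a j ≤ δ)
    (ht : ∀ j, j ≠ i → t j ∈ Set.Icc (a j) (b j)) (hs : ∀ j, s j ∈ Set.Icc (-w) w) :
    |∑ j ∈ Finset.univ.erase i, t j * s j| ≤ (ε + n * δ) * w := by
  calc |∑ j ∈ Finset.univ.erase i, t j * s j|
      ≤ ∑ j ∈ Finset.univ.erase i, |t j * s j| := Finset.abs_sum_le_sum_abs _ _
    _ ≤ ∑ j ∈ Finset.univ.erase i,
          (|p j - (1 : Matrix (Fin n) (Fin n) ℝ) i j| + δ) * w := by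
        refine Finset.sum_le_sum fun j hj => ?_
        have hji := (Finset.mem_erase.1 hj).1
        rw [Matrix.one_apply_ne' hji, sub_zero, abs_mul]
        refine mul_le_mul ?_ (abs_le.2 (hs j)) (abs_nonneg _) (by positivity)
        have h1 := hpI j hji
        have h2 := ht j hji
        have h3 := hab j hji
        have h4 : |t j - p j| ≤ δ :=
          abs_le.2 ⟨by linarith [h1.2, h2.1], by linarith [h1.1, h2.2]⟩
        linarith [abs_sub_abs_le_abs_sub (t j) (p j)]
    _ ≤ ∑ j, (|p j - (1 : Matrix (Fin n) (Fin n) ℝ) i j| + δ) * w :=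
        Finset.sum_le_sum_of_subset_of_nonneg (Finset.erase_subset _ _)
          fun _ _ _ => by positivity
    _ = (∑ j, |p j - (1 : Matrix (Fin n) (Fin n) ℝ) i j| + n * δ) * w := by
        rw [← Finset.sum_mul, Finset.sum_add_distrib]
        simp
    _ ≤ (ε + n * δ) * w := by gcongr

/-- **Sure success of the interval MK test (part a).** Under the smallness
conditions of the abstract MK test, if on each face `(2B)_i^±` the partial
derivatives `∂g_i/∂x_j` (`j ≠ i`) are enclosed in intervals of width at most
`1/(32n)`, then every element of the mean value form interval
`g_i(c_i^+) + Σ_{j≠i} I_{ij}^+·[−w, w]` is `≥ w/8 > 0`, and every element of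
`g_i(c_i^-) + Σ_{j≠i} I_{ij}^-·[−w, w]` is `≤ −w/8 < 0`. -/
theorem mk_interval_sure_success_a (n : ℕ) (f : (Fin n → ℝ) → (Fin n → ℝ))
    (hf : ContDiff ℝ 2 f) (α : Fin n → ℝ) (hroot : f α = 0)
    (c : Fin n → ℝ) (w : ℝ) (hw : 0 < w) (hα : α ∈ box n c w)
    (lam : ℝ) (hlam : w ≤ lam)
    (Δ : Set (Fin n → ℝ)) (hΔ : Δ = {x | eudist n α x ≤ 2 * Real.sqrt n * lam})
    (hinv : ∀ x ∈ Δ, IsUnit (Jmat n f x))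
    (hsmall : 27 * n * lam *
      sSup ((fun x => rowSumNorm n (((Jmat n f x)⁻¹.map fun a => |a|) * Kmat n f Δ))
        '' Δ) ≤ 1)
    (m : Fin n → ℝ) (hm : m ∈ box n c w)
    (g : (Fin n → ℝ) → (Fin n → ℝ)) (hg : ∀ x, g x = (Jmat n f m)⁻¹.mulVec (f x))
    -- the enclosing intervals `I_{ij}^+ = [pA i j, pB i j]`, `I_{ij}^- = [qA i j, qB i j]`
    (pA pB qA qB : Fin n → Fin n → ℝ)
    (hpI : ∀ i j : Fin n, j ≠ i → pA i j ≤ pB i j)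
    (hqI : ∀ i j : Fin n, j ≠ i → qA i j ≤ qB i j)
    (hpmem : ∀ i j : Fin n, j ≠ i → ∀ x ∈ facePlus n c (2 * w) i,
      pd n g i j x ∈ Set.Icc (pA i j) (pB i j))
    (hqmem : ∀ i j : Fin n, j ≠ i → ∀ x ∈ faceMinus n c (2 * w) i,
      pd n g i j x ∈ Set.Icc (qA i j) (qB i j))
    (hpw : ∀ i j : Fin n, j ≠ i → pB i j - pA i j ≤ 1 / (32 * n))
    (hqw : ∀ i j : Fin n, j ≠ i → qB i j - qA i j ≤ 1 / (32 * n)) :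
    ∀ i : Fin n,
      (∀ t s : Fin n → ℝ,
        (∀ j, j ≠ i → t j ∈ Set.Icc (pA i j) (pB i j)) →
        (∀ j, s j ∈ Set.Icc (-w) w) →
        w / 8 ≤ g (Function.update c i (c i + w)) i +
          ∑ j ∈ Finset.univ.erase i, t j * s j) ∧
      (∀ t s : Fin n → ℝ,
        (∀ j, j ≠ i → t j ∈ Set.Icc (qA i j) (qB i j)) →
        (∀ j, s j ∈ Set.Icc (-w) w) →
        g (Function.update c i (c i - w)) i +
          ∑ j ∈ Finset.univ.erase i, t j * s j ≤ -(w / 8)) := by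
  intro i
  have hn : (1 : ℝ) ≤ n := by exact_mod_cast i.pos
  have hn0 : (0 : ℝ) < n := by linarith
  have hC : IsCompact Δ := hΔ ▸ isCompact_eudist_le n α _
  have hS : Convex ℝ (box n c (2 * w)) := convex_Icc _ _
  have hB : box n c w ⊆ box n c (2 * w) := fun x hx =>
    mem_box_iff.2 fun j => (mem_box_iff.1 hx j).trans (by linarith)
  have hSC : box n c (2 * w) ⊆ Δ := by
    intro x hx
    rw [hΔ, Set.mem_ofPred]
    refine (eudist_le_sqrt_mul (r := 2 * lam) (by linarith) fun j => ?_).trans (le_of_eq (by ring))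
    rw [abs_sub_comm]
    exact (abs_sub_le_of_mem_box hx hα j).trans (by linarith)
  have hmΔ : m ∈ Δ := hSC (hB hm)
  set κ := sSup ((fun x => rowSumNorm n (((Jmat n f x)⁻¹.map fun a => |a|) * Kmat n f Δ)) '' Δ)
  have hrow := sum_le_sSup_rowSumNorm hf hC hinv (Kmat n f Δ) hmΔ i
  have hκ : 0 ≤ κ := (Finset.sum_nonneg fun _ _ => abs_nonneg _).trans hrow
  have hnorm : ∀ x ∈ box n c (2 * w), ∀ y ∈ box n c w, ‖x - y‖ ≤ 3 / 2 * w :=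
    fun x hx y hy => (pi_norm_le_iff_of_nonneg (by positivity)).2 (abs_sub_le_of_mem_box hx hy)
  have hpd : ∀ x ∈ box n c (2 * w),
      ∑ j, |pd n g i j x - (1 : Matrix (Fin n) (Fin n) ℝ) i j| ≤ 1 / 18 := by
    intro x hx
    have h1 := sum_abs_pd_sub_one_le hf hC hS hSC hx (hB hm) (hinv m hmΔ) hg i
    have h2 := mul_le_mul hrow (hnorm x hx m hm) (norm_nonneg _) hκ
    have h3 : κ * w ≤ n * lam * κ := by
      have h4 : w ≤ n * lam := by nlinarith
      nlinarith [mul_le_mul_of_nonneg_right h4 hκ]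
    linarith
  have hgd : Differentiable ℝ g := by
    rw [funext hg]
    exact (Matrix.mulVecLin (Jmat n f m)⁻¹).toContinuousLinearMap.differentiable.comp
      (hf.differentiable two_ne_zero)
  have hgα : g α = 0 := by rw [hg, hroot, Matrix.mulVec_zero]
  have hcenter : ∀ r : ℝ, |r| ≤ w → Function.update c i (c i + r) ∈ box n c (2 * w) := by
    intro r hr
    refine mem_box_iff.2 fun j => ?_
    rcases eq_or_ne j i with rfl | hj
    · simpa using hr
    · simpa [hj] using hw.le
  have hval : ∀ r : ℝ, |r| ≤ w →
      |g (Function.update c i (c i + r)) i - (c i + r - α i)| ≤ w / 12 := by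
    intro r hr
    have h1 := abs_sub_sub_sub_le hgd hS hpd (hcenter r hr) (hB hα)
    have h2 := hnorm _ (hcenter r hr) α hα
    rw [hgα, Function.update_self, Pi.zero_apply] at h1
    rw [show g (Function.update c i (c i + r)) i - (c i + r - α i) =
      g (Function.update c i (c i + r)) i - (c i + r) - (0 - α i) by ring]
    linarith
  have hαi := abs_le.1 (mem_box_iff.1 hα i)
  have hδ : (n : ℝ) * (1 / (32 * n)) = 1 / 32 := by field_simp
  constructor
  · intro t s ht hs
    have hc := hcenter w (abs_of_pos hw).le
    have h1 := abs_le.1 (hval w (abs_of_pos hw).le)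
    have h2 := abs_sum_erase_mul_le i hw.le (by positivity) (hpd _ hc)
      (fun j hj => hpmem i j hj _ ⟨hc, by simp⟩) (hpw i) ht hs
    rw [hδ] at h2
    linarith [(abs_le.1 h2).1]
  · intro t s ht hs
    have hr : |-w| ≤ w := by rw [abs_neg, abs_of_pos hw]
    have hc := hcenter (-w) hr
    have h1 := abs_le.1 (hval (-w) hr)
    have h2 := abs_sum_erase_mul_le i hw.le (by positivity) (hpd _ hc)
      (fun j hj => hqmem i j hj _ ⟨hc, by simp; ring⟩) (hqw i) ht hs
    rw [hδ] at h2
    rw [sub_eq_add_neg]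
    linarith [(abs_le.1 h2).2]
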